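/- There exist a constant C5 > 0 and a natural number n0 such that for all integers n ≥ n0 with k ≤ n the following holds: if p_1 ≥ p_2 ≥ … ≥ p_k, h·p_1 ≥ 324·log n, and j ∈ {2,…,k} satisfies δ(j) := p_1 − p_j ≤ √(2·(p_1 + p_2)/h), then Pr(W_1) − Pr(W_j) ≥ C5 · δ(j) · √(h/(p_1 + p_2)) · Pr(W_1). -/

import Mathlib

open scoped BigOperators

noncomputable section

/-- The number of the `h` i.i.d. samples `ω` that are equal to opinion `i`. -/
def cnt {k h : ℕ} (ω : Fin h → Fin k) (i : Fin k) : ℕ :=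
  (Finset.univ.filter fun j => ω j = i).card

/-- The probability of the event `A` under `h` i.i.d. samples drawn from the
probability vector `p` on `Fin k` (multinomial sampling). -/
def multiPr (k h : ℕ) (p : Fin k → ℝ) (A : Set (Fin h → Fin k)) : ℝ :=
  ∑ ω : Fin h → Fin k, A.indicator (fun ω => ∏ j, p (ω j)) ω

/-- The maximal number of samples received by an opinion. -/
def maxCnt {k h : ℕ} (ω : Fin h → Fin k) : ℕ :=
  Finset.univ.sup (cnt ω)

/-- The number of opinions achieving the maximal number of samples. -/
def numMax {k h : ℕ} (ω : Fin h → Fin k) : ℕ :=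
  (Finset.univ.filter fun i => cnt ω i = maxCnt ω).card

/-- The probability that opinion `i` wins the `h`-majority with uniform
tie-breaking, jointly with the event `A`:
`E[ 1_A · 1{X_i = max_l X_l} / #{l : X_l maximal} ]`. -/
def winPrOn (k h : ℕ) (p : Fin k → ℝ) (A : Set (Fin h → Fin k)) (i : Fin k) : ℝ :=
  ∑ ω : Fin h → Fin k,
    (A ∩ {ω' | cnt ω' i = maxCnt ω'}).indicator
      (fun ω => (∏ j, p (ω j)) / (numMax ω : ℝ)) ω

/-- The probability that opinion `i` wins the `h`-majority with uniform tie-breaking. -/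
def winPr (k h : ℕ) (p : Fin k → ℝ) (i : Fin k) : ℝ :=
  winPrOn k h p Set.univ i

/-- `W_{i,strict}`: opinion `i` is the unique most sampled opinion. -/
def Wstrict (k h : ℕ) (i : Fin k) : Set (Fin h → Fin k) :=
  {ω | ∀ j, j ≠ i → cnt ω j < cnt ω i}

/-- `W_{i,ties}`: opinion `i` is among the most sampled opinions. -/
def Wties (k h : ℕ) (i : Fin k) : Set (Fin h → Fin k) :=
  {ω | ∀ j, j ≠ i → cnt ω j ≤ cnt ω i}

/-- `W_{1,2,strict}`: opinion `i₁` or opinion `i₂` is the unique most sampled opinion. -/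
def W12strict (k h : ℕ) (i₁ i₂ : Fin k) : Set (Fin h → Fin k) :=
  Wstrict k h i₁ ∪ Wstrict k h i₂

/-- Opinion 1 (as an element of `Fin k`, assuming `2 ≤ k`). -/
def o₁ (k : ℕ) (hk : 2 ≤ k) : Fin k := ⟨0, by omega⟩

/-- Opinion 2 (as an element of `Fin k`, assuming `2 ≤ k`). -/
def o₂ (k : ℕ) (hk : 2 ≤ k) : Fin k := ⟨1, by omega⟩

/-- The share of the win that opinion `i` receives at the sample `ω`. -/
def winShare {k h : ℕ} (ω : Fin h → Fin k) (i : Fin k) : ℝ :=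
  if cnt ω i = maxCnt ω then 1 / (numMax ω : ℝ) else 0

lemma winPr_eq_sum (k h : ℕ) (p : Fin k → ℝ) (i : Fin k) :
    winPr k h p i = ∑ ω : Fin h → Fin k, (∏ x, p (ω x)) * winShare ω i := by
  unfold winPr winPrOn winShare
  refine Finset.sum_congr rfl fun ω _ => ?_
  by_cases hω : cnt ω i = maxCnt ω <;> simp [Set.indicator, hω, div_eq_mul_inv]

lemma winShare_nonneg {k h : ℕ} (ω : Fin h → Fin k) (i : Fin k) : 0 ≤ winShare ω i := by
  unfold winShare
  split_ifs <;> positivity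

lemma cnt_le_maxCnt {k h : ℕ} (ω : Fin h → Fin k) (i : Fin k) : cnt ω i ≤ maxCnt ω :=
  Finset.le_sup (f := cnt ω) (Finset.mem_univ i)

lemma cnt_eq_maxCnt_iff {k h : ℕ} (ω : Fin h → Fin k) (i : Fin k) :
    cnt ω i = maxCnt ω ↔ ∀ l, cnt ω l ≤ cnt ω i := by
  constructor
  · intro hi l
    rw [hi]
    exact cnt_le_maxCnt ω l
  · intro hi
    exact le_antisymm (cnt_le_maxCnt ω i) (Finset.sup_le fun l _ => hi l)

lemma numMax_pos {k h : ℕ} (ω : Fin h → Fin k) (i : Fin k) : 0 < numMax ω := by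
  obtain ⟨l, -, hl⟩ := Finset.exists_mem_eq_sup Finset.univ ⟨i, Finset.mem_univ i⟩ (cnt ω)
  exact Finset.card_pos.mpr ⟨l, Finset.mem_filter.mpr ⟨Finset.mem_univ l, hl.symm⟩⟩

lemma winShare_le_one {k h : ℕ} (ω : Fin h → Fin k) (i : Fin k) : winShare ω i ≤ 1 := by
  unfold winShare
  split_ifs
  · have : (1 : ℝ) ≤ numMax ω := by exact_mod_cast numMax_pos ω i
    exact div_le_one_of_le₀ this (by positivity)
  · exact zero_le_one

lemma sum_winShare {k h : ℕ} (ω : Fin h → Fin k) (i₀ : Fin k) : ∑ i, winShare ω i = 1 := by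
  have hpos : (0 : ℝ) < numMax ω := by exact_mod_cast numMax_pos ω i₀
  unfold winShare
  rw [← Finset.sum_filter, Finset.sum_const, nsmul_eq_mul]
  exact mul_one_div_cancel hpos.ne'

lemma sum_prod_eq_one {k h : ℕ} {p : Fin k → ℝ} (hp : ∑ i, p i = 1) :
    ∑ ω : Fin h → Fin k, ∏ x, p (ω x) = 1 := by
  rw [← Fintype.prod_sum (f := fun (_ : Fin h) i => p i)]
  simp [hp]

lemma sum_winPr {k : ℕ} (h : ℕ) {p : Fin k → ℝ} (hp : ∑ i, p i = 1) (i₀ : Fin k) :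
    ∑ i, winPr k h p i = 1 := by
  simp_rw [winPr_eq_sum]
  rw [Finset.sum_comm]
  simp_rw [← Finset.mul_sum, sum_winShare _ i₀, mul_one]
  exact sum_prod_eq_one hp

/-- Moving samples towards opinion `i` can only increase its share of the win. -/
lemma winShare_mono {k h : ℕ} {ω ω' : Fin h → Fin k} {i : Fin k}
    (hi : cnt ω i ≤ cnt ω' i) (hl : ∀ l, l ≠ i → cnt ω' l ≤ cnt ω l) :
    winShare ω i ≤ winShare ω' i := by
  by_cases hω : cnt ω i = maxCnt ω
  · have hmax := (cnt_eq_maxCnt_iff ω i).mp hω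
    have hω' : cnt ω' i = maxCnt ω' := by
      refine (cnt_eq_maxCnt_iff ω' i).mpr fun l => ?_
      by_cases hli : l = i
      · rw [hli]
      · exact (hl l hli).trans ((hmax l).trans hi)
    have hle : numMax ω' ≤ numMax ω := by
      refine Finset.card_le_card fun l hmem => ?_
      simp only [Finset.mem_filter, Finset.mem_univ, true_and] at hmem ⊢
      by_cases hli : l = i
      · rw [hli, hω]
      · have h1 := hl l hli
        have h2 := hmax l
        omega
    have hpos : (0 : ℝ) < numMax ω' := by exact_mod_cast numMax_pos ω' i
    simp only [winShare, hω, hω', if_true]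
    exact one_div_le_one_div_of_le hpos (by exact_mod_cast hle)
  · rw [winShare, if_neg hω]
    exact winShare_nonneg ω' i

lemma prod_comp_eq_prod_pow_cnt {k h : ℕ} (p : Fin k → ℝ) (ω : Fin h → Fin k) :
    ∏ x, p (ω x) = ∏ i, p i ^ cnt ω i := by
  rw [← Finset.prod_fiberwise_of_maps_to (s := Finset.univ) (t := Finset.univ) (g := ω)
    (fun _ _ => Finset.mem_univ _)]
  refine Finset.prod_congr rfl fun i _ => ?_
  rw [cnt, ← Finset.prod_const]
  exact Finset.prod_congr rfl fun x hx => by rw [(Finset.mem_filter.mp hx).2]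

lemma cnt_equiv_comp {k h : ℕ} (e : Fin k ≃ Fin k) (ω : Fin h → Fin k) (i : Fin k) :
    cnt (fun x => e (ω x)) (e i) = cnt ω i := by
  simp [cnt]

lemma maxCnt_equiv_comp {k h : ℕ} (e : Fin k ≃ Fin k) (ω : Fin h → Fin k) :
    maxCnt (fun x => e (ω x)) = maxCnt ω := by
  refine le_antisymm (Finset.sup_le fun i _ => ?_) (Finset.sup_le fun i _ => ?_)
  · rw [← e.apply_symm_apply i, cnt_equiv_comp]
    exact cnt_le_maxCnt _ _
  · rw [← cnt_equiv_comp e]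
    exact cnt_le_maxCnt _ _

lemma winShare_equiv_comp {k h : ℕ} (e : Fin k ≃ Fin k) (ω : Fin h → Fin k) (i : Fin k) :
    winShare (fun x => e (ω x)) (e i) = winShare ω i := by
  have hnum : numMax (fun x => e (ω x)) = numMax ω := by
    unfold numMax
    rw [maxCnt_equiv_comp]
    refine (Finset.card_bij (fun i _ => e i) ?_ ?_ ?_).symm
    · intro l hl
      simpa [cnt_equiv_comp] using hl
    · intro _ _ _ _ hll
      exact e.injective hll
    · intro l hl
      refine ⟨e.symm l, ?_, by simp⟩
      have hcnt := cnt_equiv_comp e ω (e.symm l)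
      rw [e.apply_symm_apply] at hcnt
      simpa [← hcnt] using hl
  unfold winShare
  rw [cnt_equiv_comp, maxCnt_equiv_comp, hnum]

/-- Exchanging the roles of two opinions multiplies the probability of a sample by a power of
the ratio of their probabilities. -/
lemma prod_swap {k h : ℕ} (p : Fin k → ℝ) {a b : Fin k} (hab : a ≠ b) (ha : p a ≠ 0)
    {ω : Fin h → Fin k} (hω : cnt ω b ≤ cnt ω a) :
    ∏ x, p (Equiv.swap a b (ω x)) =
      (∏ x, p (ω x)) * (p b / p a) ^ (cnt ω a - cnt ω b) := by
  have split (f : Fin k → ℝ) : ∏ i, f i = f a * f b * ∏ i ∈ {a, b}ᶜ, f i := by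
    rw [← Finset.prod_pair hab, Finset.prod_mul_prod_compl]
  rw [prod_comp_eq_prod_pow_cnt (fun i => p (Equiv.swap a b i)), prod_comp_eq_prod_pow_cnt,
    split, split]
  have hrest : ∏ i ∈ ({a, b} : Finset (Fin k))ᶜ, p (Equiv.swap a b i) ^ cnt ω i =
      ∏ i ∈ ({a, b} : Finset (Fin k))ᶜ, p i ^ cnt ω i := by
    refine Finset.prod_congr rfl fun i hi => ?_
    simp only [Finset.mem_compl, Finset.mem_insert, Finset.mem_singleton, not_or] at hi
    rw [Equiv.swap_apply_of_ne_of_ne hi.1 hi.2]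
  rw [hrest, Equiv.swap_apply_left, Equiv.swap_apply_right]
  obtain ⟨d, hd⟩ := Nat.exists_eq_add_of_le hω
  rw [hd, Nat.add_sub_cancel_left, div_pow, pow_add, pow_add]
  field_simp

lemma winPr_sub_winPr {k h : ℕ} (p : Fin k → ℝ) {a b : Fin k} (hab : a ≠ b) (ha : p a ≠ 0) :
    winPr k h p a - winPr k h p b =
      ∑ ω : Fin h → Fin k, (∏ x, p (ω x)) *
        (winShare ω a * (1 - (p b / p a) ^ (cnt ω a - cnt ω b))) := by
  have hb : winPr k h p b = ∑ ω : Fin h → Fin k,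
      (∏ x, p (Equiv.swap a b (ω x))) * winShare ω a := by
    rw [winPr_eq_sum, ← (Equiv.arrowCongr (Equiv.refl (Fin h)) (Equiv.swap a b)).sum_comp]
    refine Finset.sum_congr rfl fun ω _ => ?_
    have := winShare_equiv_comp (Equiv.swap a b) ω a
    rw [Equiv.swap_apply_left] at this
    rw [← this]
    rfl
  rw [hb, winPr_eq_sum, ← Finset.sum_sub_distrib]
  refine Finset.sum_congr rfl fun ω _ => ?_
  by_cases hω : cnt ω b ≤ cnt ω a
  · rw [prod_swap p hab ha hω]
    ring
  · have : winShare ω a = 0 := by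
      rw [winShare, if_neg]
      rw [cnt_eq_maxCnt_iff]
      exact fun hall => hω (hall b)
    rw [this]
    ring

lemma sum_prod_comp {ι α γ : Type*} [Fintype ι] [DecidableEq ι] [Fintype α] [DecidableEq α]
    [Fintype γ] [DecidableEq γ] (T : α → γ) (w : α → ℝ) (v : γ → ℝ)
    (hT : ∀ c, ∑ z with T z = c, w z = v c) (F : (ι → γ) → ℝ) :
    ∑ ζ : ι → α, (∏ x, w (ζ x)) * F (fun x => T (ζ x)) =
      ∑ ω : ι → γ, (∏ x, v (ω x)) * F ω := by
  rw [← Finset.sum_fiberwise_of_maps_to (s := Finset.univ) (t := Finset.univ)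
    (g := fun (ζ : ι → α) x => T (ζ x)) (fun _ _ => Finset.mem_univ _)]
  refine Finset.sum_congr rfl fun ω _ => ?_
  simp_rw [← hT]
  rw [Finset.prod_univ_sum, Finset.sum_mul]
  refine Finset.sum_congr ?_ fun ζ hζ => ?_
  · ext ζ
    simp [funext_iff]
  · simp only [Fintype.mem_piFinset, Finset.mem_filter, Finset.mem_univ, true_and] at hζ
    rw [show (fun x => T (ζ x)) = ω from funext hζ]

/-- Replace a sample equal to `a` or `b` by `a` or `b`, according to the bit `s`. -/
def resample {k : ℕ} (a b i : Fin k) (s : Bool) : Fin k :=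
  if i = a ∨ i = b then (if s then a else b) else i

/-- The weight of a bit that is `true` with probability `q`. -/
def bitWeight (q : ℝ) (s : Bool) : ℝ := if s then q else 1 - q

lemma sum_resample {k h : ℕ} (p : Fin k → ℝ) {a b : Fin k} (hab : a ≠ b)
    (hp : p a + p b ≠ 0) (F : (Fin h → Fin k) → ℝ) :
    ∑ ω : Fin h → Fin k, ∑ s : Fin h → Bool,
      (∏ x, p (ω x)) * (∏ x, bitWeight (p a / (p a + p b)) (s x)) *
        F (fun x => resample a b (ω x) (s x)) =
      ∑ ω : Fin h → Fin k, (∏ x, p (ω x)) * F ω := by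
  rw [← Fintype.sum_prod_type',
    ← (Equiv.arrowProdEquivProdArrow (Fin h) (fun _ => Fin k) (fun _ => Bool)).sum_comp,
    ← sum_prod_comp (fun z : Fin k × Bool => resample a b z.1 z.2)
      (fun z => p z.1 * bitWeight (p a / (p a + p b)) z.2) p]
  · refine Finset.sum_congr rfl fun ζ _ => ?_
    rw [Finset.prod_mul_distrib]
    rfl
  · intro c
    have hpair (y : ℝ) : ∑ i, (if i = a ∨ i = b then p i * y else 0) = (p a + p b) * y := by
      rw [← Finset.sum_filter, show Finset.univ.filter (fun i => i = a ∨ i = b) = {a, b} by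
        ext; simp, Finset.sum_pair hab]
      ring
    rw [Finset.sum_filter, Fintype.sum_prod_type]
    simp only [Fintype.sum_bool, bitWeight, if_true, Bool.false_eq_true, if_false,
      Finset.sum_add_distrib]
    by_cases hca : c = a
    · subst hca
      have h1 (i) : resample c b i true = c ↔ i = c ∨ i = b := by
        unfold resample; grind
      have h2 (i) : ¬ resample c b i false = c := by
        unfold resample; grind
      simp only [h1, h2, hpair, if_false]
      field_simp
      simp
    by_cases hcb : c = b
    · subst hcb
      have h1 (i) : resample a c i false = c ↔ i = a ∨ i = c := by
        unfold resample; grind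
      have h2 (i) : ¬ resample a c i true = c := by
        unfold resample; grind
      simp only [h1, h2, hpair, if_false]
      field_simp
      simp
    · have h1 (i s) : resample a b i s = c ↔ i = c := by
        unfold resample; grind
      simp only [h1, Finset.sum_ite_eq', Finset.mem_univ, if_true]
      ring

/-- The step of a simple walk given by a bit. -/
def bitSign (s : Bool) : ℝ := if s then 1 else -1

lemma bitSign_not (s : Bool) : bitSign (!s) = -bitSign s := by
  cases s <;> simp [bitSign]

lemma bitSign_sq (s : Bool) : bitSign s ^ 2 = 1 := by
  cases s <;> simp [bitSign]

lemma sum_mul_bitSign_eq_zero {ι : Type*} [Fintype ι] [DecidableEq ι] (F : (ι → Bool) → ℝ) (a : ι)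
    (hF : ∀ s, F (Function.update s a (!s a)) = F s) :
    ∑ s : ι → Bool, F s * bitSign (s a) = 0 := by
  refine Finset.sum_involution (fun s _ => Function.update s a (!s a)) ?_ ?_ ?_ ?_
  · intro s _
    rw [hF, Function.update_self, bitSign_not]
    ring
  · intro s _ _ heq
    have := congrFun heq a
    simp at this
  · intro s _
    exact Finset.mem_univ _
  · intro s _
    simp

lemma sum_bitSign_update {ι : Type*} [DecidableEq ι] {A : Finset ι} {a : ι} (ha : a ∉ A)
    (s : ι → Bool) (y : Bool) :
    ∑ x ∈ A, bitSign (Function.update s a y x) = ∑ x ∈ A, bitSign (s x) := by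
  refine Finset.sum_congr rfl fun x hx => ?_
  rw [Function.update_of_ne (ne_of_mem_of_not_mem hx ha)]

/-- The second moment of the simple walk. -/
lemma sum_walk_sq {ι : Type*} [Fintype ι] [DecidableEq ι] (A : Finset ι) :
    ∑ s : ι → Bool, (∑ x ∈ A, bitSign (s x)) ^ 2 = 2 ^ Fintype.card ι * (A.card : ℝ) := by
  induction A using Finset.induction_on with
  | empty => simp
  | insert a A ha ih =>
    have hzero := sum_mul_bitSign_eq_zero (fun s => ∑ x ∈ A, bitSign (s x)) a
      (fun s => sum_bitSign_update ha s _)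
    have hexp (s : ι → Bool) : (∑ x ∈ insert a A, bitSign (s x)) ^ 2 =
        (∑ x ∈ A, bitSign (s x)) ^ 2 + 2 * ((∑ x ∈ A, bitSign (s x)) * bitSign (s a)) + 1 := by
      rw [Finset.sum_insert ha]
      linear_combination bitSign_sq (s a)
    simp_rw [hexp, Finset.sum_add_distrib, ← Finset.mul_sum, hzero, ih,
      Finset.card_insert_of_notMem ha]
    simp
    ring

/-- A bound on the fourth moment of the simple walk. -/
lemma sum_walk_pow_four_le {ι : Type*} [Fintype ι] [DecidableEq ι] (A : Finset ι) :
    ∑ s : ι → Bool, (∑ x ∈ A, bitSign (s x)) ^ 4 ≤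
      2 ^ Fintype.card ι * (3 * (A.card : ℝ) ^ 2) := by
  induction A using Finset.induction_on with
  | empty => simp
  | insert a A ha ih =>
    have hzero := sum_mul_bitSign_eq_zero
      (fun s => 4 * (∑ x ∈ A, bitSign (s x)) ^ 3 + 4 * ∑ x ∈ A, bitSign (s x)) a
      (fun s => by simp only [sum_bitSign_update ha])
    have hexp (s : ι → Bool) : (∑ x ∈ insert a A, bitSign (s x)) ^ 4 =
        (∑ x ∈ A, bitSign (s x)) ^ 4 +
          (4 * (∑ x ∈ A, bitSign (s x)) ^ 3 + 4 * ∑ x ∈ A, bitSign (s x)) * bitSign (s a) +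
          6 * (∑ x ∈ A, bitSign (s x)) ^ 2 + 1 := by
      rw [Finset.sum_insert ha]
      linear_combination (6 * (∑ x ∈ A, bitSign (s x)) ^ 2 +
        4 * (∑ x ∈ A, bitSign (s x)) * bitSign (s a) + bitSign (s a) ^ 2 + 1) * bitSign_sq (s a)
    simp_rw [hexp, Finset.sum_add_distrib, ← Finset.mul_sum, sum_walk_sq]
    rw [hzero, Finset.card_insert_of_notMem ha]
    have hpow : (0 : ℝ) < 2 ^ Fintype.card ι := by positivity
    simp only [Finset.sum_const, Finset.card_univ, Fintype.card_fun, Fintype.card_bool,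
      nsmul_eq_mul]
    push_cast
    nlinarith

lemma one_sub_pow_ge {r : ℝ} (hr0 : 0 ≤ r) (hr1 : r ≤ 1) (d : ℕ) :
    (1 - r) * d / (1 + (1 - r) * d) ≤ 1 - r ^ d := by
  have hε : 0 ≤ (1 - r) * (d : ℝ) := mul_nonneg (by linarith) (by positivity)
  have hbern : 1 + (d : ℝ) * (1 - r) ≤ (1 + (1 - r)) ^ d :=
    one_add_mul_le_pow (by linarith) d
  have hprod : r ^ d * (1 + (1 - r)) ^ d ≤ 1 := by
    rw [← mul_pow]
    exact pow_le_one₀ (mul_nonneg hr0 (by linarith)) (by nlinarith [sq_nonneg (1 - r)])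
  have hmul := mul_le_mul_of_nonneg_left hbern (pow_nonneg hr0 d)
  rw [div_le_iff₀ (by linarith)]
  nlinarith

lemma quartic_le_div {κ z : ℝ} (hκ : 0 ≤ κ) (hz : 0 ≤ z) :
    κ / (1 + κ) * (z ^ 2 / 2 - z ^ 4 / 16) ≤ κ * z / (1 + κ * z) := by
  have hκz : 0 ≤ κ * z := mul_nonneg hκ hz
  rcases le_total z 1 with hz1 | hz1
  · have hQ : z ^ 2 / 2 - z ^ 4 / 16 ≤ z := by nlinarith [sq_nonneg (z ^ 2)]
    calc κ / (1 + κ) * (z ^ 2 / 2 - z ^ 4 / 16) ≤ κ / (1 + κ) * z := by gcongr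
      _ = κ * z / (1 + κ) := by ring
      _ ≤ κ * z / (1 + κ * z) := by
        gcongr
        exact mul_le_of_le_one_right hκ hz1
  · have hQ : z ^ 2 / 2 - z ^ 4 / 16 ≤ 1 := by nlinarith [sq_nonneg (z ^ 2 - 4)]
    calc κ / (1 + κ) * (z ^ 2 / 2 - z ^ 4 / 16) ≤ κ / (1 + κ) * 1 := by gcongr
      _ ≤ κ * z / (1 + κ * z) := by
        rw [mul_one, div_le_div_iff₀ (by linarith) (by linarith)]
        nlinarith

lemma quartic_le_one_sub_pow {r : ℝ} (hr0 : 0 ≤ r) (hr1 : r ≤ 1) {m : ℝ} (hm : 0 < m) (d : ℕ) :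
    (1 - r) * √m / (1 + (1 - r) * √m) * ((d : ℝ) ^ 2 / (2 * m) - (d : ℝ) ^ 4 / (16 * m ^ 2)) ≤
      1 - r ^ d := by
  have hL : 0 < √m := Real.sqrt_pos.mpr hm
  have hLm : √m ^ 2 = m := Real.sq_sqrt hm.le
  have hκ : 0 ≤ (1 - r) * √m := mul_nonneg (by linarith) hL.le
  have hquart := quartic_le_div hκ (div_nonneg (Nat.cast_nonneg d) hL.le : 0 ≤ (d : ℝ) / √m)
  have h2 : ((d : ℝ) / √m) ^ 2 = (d : ℝ) ^ 2 / m := by rw [div_pow, hLm]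
  have h4 : ((d : ℝ) / √m) ^ 4 = (d : ℝ) ^ 4 / m ^ 2 := by
    rw [div_pow, show √m ^ 4 = (√m ^ 2) ^ 2 by ring, hLm]
  have h1 : (1 - r) * √m * ((d : ℝ) / √m) = (1 - r) * d := by field_simp
  rw [h1, h2, h4, div_div, div_div, mul_comm m 2, mul_comm (m ^ 2) 16] at hquart
  exact hquart.trans (one_sub_pow_ge hr0 hr1 d)

lemma quartic_le_one_sub_pow_add {r : ℝ} (hr0 : 0 ≤ r) (hr1 : r ≤ 1) {m : ℝ} (hm : 0 < m)
    (u v : ℕ) :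
    (1 - r) * √m / (1 + (1 - r) * √m) *
        (((u : ℝ) - v) ^ 2 / (2 * m) - ((u : ℝ) - v) ^ 4 / (16 * m ^ 2)) ≤
      (1 - r ^ (u - v)) + (1 - r ^ (v - u)) := by
  rcases le_total v u with hvu | hvu
  · have := quartic_le_one_sub_pow hr0 hr1 hm (u - v)
    rw [Nat.cast_sub hvu] at this
    simpa [Nat.sub_eq_zero_of_le hvu] using this
  · have := quartic_le_one_sub_pow hr0 hr1 hm (v - u)
    rw [Nat.cast_sub hvu] at this
    rw [show ((u : ℝ) - v) ^ 2 = ((v : ℝ) - u) ^ 2 by ring,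
      show ((u : ℝ) - v) ^ 4 = ((v : ℝ) - u) ^ 4 by ring]
    simpa [Nat.sub_eq_zero_of_le hvu] using this

lemma sum_bitSign_eq {ι : Type*} (A : Finset ι) (s : ι → Bool) :
    ∑ x ∈ A, bitSign (s x) =
      ((A.filter fun x => s x = true).card : ℝ) - (A.filter fun x => s x = false).card := by
  rw [Finset.card_filter, Finset.card_filter]
  push_cast
  rw [← Finset.sum_sub_distrib]
  refine Finset.sum_congr rfl fun x _ => ?_
  cases s x <;> simp [bitSign]

/-- Anti-concentration of the fair walk, tested against `d ↦ 1 - r ^ d`. -/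
lemma sum_one_sub_pow_ge {ι : Type*} [Fintype ι] [DecidableEq ι] {r : ℝ} (hr0 : 0 ≤ r)
    (hr1 : r ≤ 1) {A : Finset ι} (hA : 0 < A.card) :
    2 ^ Fintype.card ι * (5 / 32 * ((1 - r) * √A.card / (1 + (1 - r) * √A.card))) ≤
      ∑ s : ι → Bool, (1 - r ^ ((A.filter fun x => s x = true).card -
        (A.filter fun x => s x = false).card)) := by
  have hm : (0 : ℝ) < A.card := by exact_mod_cast hA
  set m : ℝ := (A.card : ℝ) with hmdef
  set K : ℝ := (1 - r) * √m / (1 + (1 - r) * √m) with hK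
  have hκ : 0 ≤ (1 - r) * √m := mul_nonneg (by linarith) (Real.sqrt_nonneg m)
  have hK0 : 0 ≤ K := by positivity
  have hflip : ∑ s : ι → Bool, (1 - r ^ ((A.filter fun x => s x = true).card -
        (A.filter fun x => s x = false).card)) =
      ∑ s : ι → Bool, (1 - r ^ ((A.filter fun x => s x = false).card -
        (A.filter fun x => s x = true).card)) := by
    rw [← (Equiv.arrowCongr (Equiv.refl ι) Equiv.boolNot).sum_comp]
    refine Finset.sum_congr rfl fun s _ => ?_
    simp
  have hsum : ∑ s : ι → Bool, K * ((∑ x ∈ A, bitSign (s x)) ^ 2 / (2 * m) -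
        (∑ x ∈ A, bitSign (s x)) ^ 4 / (16 * m ^ 2)) ≤
      ∑ s : ι → Bool, ((1 - r ^ ((A.filter fun x => s x = true).card -
        (A.filter fun x => s x = false).card)) +
        (1 - r ^ ((A.filter fun x => s x = false).card -
        (A.filter fun x => s x = true).card))) := by
    refine Finset.sum_le_sum fun s _ => ?_
    rw [sum_bitSign_eq]
    exact quartic_le_one_sub_pow_add hr0 hr1 hm _ _
  rw [Finset.sum_add_distrib, ← hflip, ← Finset.mul_sum, Finset.sum_sub_distrib,
    ← Finset.sum_div, ← Finset.sum_div, sum_walk_sq] at hsum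
  have h4 : (∑ s : ι → Bool, (∑ x ∈ A, bitSign (s x)) ^ 4) / (16 * m ^ 2) ≤
      2 ^ Fintype.card ι * (3 / 16) := by
    rw [div_le_iff₀ (by positivity)]
    have := sum_walk_pow_four_le A
    rw [← hmdef] at this
    linarith
  have h2 : 2 ^ Fintype.card ι * m / (2 * m) = 2 ^ Fintype.card ι * (1 / 2) := by
    field_simp
  rw [← hmdef, h2] at hsum
  have := mul_le_mul_of_nonneg_left (sub_le_sub_left h4 (2 ^ Fintype.card ι * (1 / 2))) hK0
  linarith

lemma cnt_resample_left {k h : ℕ} {a b : Fin k} (hab : a ≠ b) (ω : Fin h → Fin k)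
    (s : Fin h → Bool) :
    cnt (fun x => resample a b (ω x) (s x)) a =
      ((Finset.univ.filter fun x => ω x = a ∨ ω x = b).filter fun x => s x = true).card := by
  unfold cnt
  congr 1
  ext x
  simp only [Finset.mem_filter, Finset.mem_univ, true_and, resample]
  grind

lemma cnt_resample_right {k h : ℕ} {a b : Fin k} (hab : a ≠ b) (ω : Fin h → Fin k)
    (s : Fin h → Bool) :
    cnt (fun x => resample a b (ω x) (s x)) b =
      ((Finset.univ.filter fun x => ω x = a ∨ ω x = b).filter fun x => s x = false).card := by
  unfold cnt
  congr 1
  ext x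
  simp only [Finset.mem_filter, Finset.mem_univ, true_and, resample]
  grind

lemma cnt_resample_of_ne {k h : ℕ} {a b l : Fin k} (ha : l ≠ a) (hb : l ≠ b)
    (ω : Fin h → Fin k) (s : Fin h → Bool) :
    cnt (fun x => resample a b (ω x) (s x)) l = cnt ω l := by
  unfold cnt
  congr 1
  ext x
  simp only [Finset.mem_filter, Finset.mem_univ, true_and, resample]
  grind

lemma cnt_resample_left_mono {k h : ℕ} {a b : Fin k} (hab : a ≠ b) (ω : Fin h → Fin k)
    {s t : Fin h → Bool} (hst : s ≤ t) :
    cnt (fun x => resample a b (ω x) (s x)) a ≤ cnt (fun x => resample a b (ω x) (t x)) a := by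
  rw [cnt_resample_left hab, cnt_resample_left hab]
  refine Finset.card_le_card (Finset.monotone_filter_right _ fun x _ hx => ?_)
  exact top_le_iff.mp (hx.symm.trans_le (hst x))

lemma cnt_resample_right_anti {k h : ℕ} {a b : Fin k} (hab : a ≠ b) (ω : Fin h → Fin k)
    {s t : Fin h → Bool} (hst : s ≤ t) :
    cnt (fun x => resample a b (ω x) (t x)) b ≤ cnt (fun x => resample a b (ω x) (s x)) b := by
  rw [cnt_resample_right hab, cnt_resample_right hab]
  refine Finset.card_le_card (Finset.monotone_filter_right _ fun x _ hx => ?_)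
  exact le_bot_iff.mp ((hst x).trans_eq hx)

lemma winShare_resample_mono {k h : ℕ} {a b : Fin k} (hab : a ≠ b) (ω : Fin h → Fin k) :
    Monotone fun s : Fin h → Bool => winShare (fun x => resample a b (ω x) (s x)) a := by
  intro s t hst
  refine winShare_mono (cnt_resample_left_mono hab ω hst) fun l hl => ?_
  by_cases hlb : l = b
  · rw [hlb]
    exact cnt_resample_right_anti hab ω hst
  · rw [cnt_resample_of_ne hl hlb, cnt_resample_of_ne hl hlb]

lemma prod_bitWeight_mono {ι : Type*} [Fintype ι] {q : ℝ} (hq : 1 / 2 ≤ q) (hq1 : q ≤ 1) :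
    Monotone fun s : ι → Bool => ∏ x, bitWeight q (s x) := by
  intro s t hst
  refine Finset.prod_le_prod (fun x _ => ?_) fun x _ => ?_
  · unfold bitWeight
    split_ifs <;> linarith
  · have := hst x
    revert this
    cases s x <;> cases t x <;> simp [bitWeight]
    linarith

lemma prod_bitWeight_nonneg {ι : Type*} [Fintype ι] {q : ℝ} (hq : 0 ≤ q) (hq1 : q ≤ 1)
    (s : ι → Bool) : 0 ≤ ∏ x, bitWeight q (s x) := by
  refine Finset.prod_nonneg fun x _ => ?_
  unfold bitWeight
  split_ifs <;> linarith

/-- The Harris inequality for a biased resampling of two opinions, compared with a fair one. -/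
lemma winShare_gain_correlation {k h : ℕ} {a b : Fin k} (hab : a ≠ b) {q r : ℝ}
    (hq : 1 / 2 ≤ q) (hq1 : q ≤ 1) (hr0 : 0 ≤ r) (hr1 : r ≤ 1) (ω : Fin h → Fin k) :
    (∑ s : Fin h → Bool, (∏ x, bitWeight q (s x)) *
        winShare (fun x => resample a b (ω x) (s x)) a) *
      (∑ s : Fin h → Bool, (1 - r ^ (cnt (fun x => resample a b (ω x) (s x)) a -
        cnt (fun x => resample a b (ω x) (s x)) b))) ≤
    2 ^ h * ∑ s : Fin h → Bool, (∏ x, bitWeight q (s x)) *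
      (winShare (fun x => resample a b (ω x) (s x)) a *
        (1 - r ^ (cnt (fun x => resample a b (ω x) (s x)) a -
          cnt (fun x => resample a b (ω x) (s x)) b))) := by
  have hq0 : 0 ≤ q := by linarith
  have := fkg (α := Fin h → Bool) (β := ℝ) (μ := fun _ => 1)
    (f := fun s => (∏ x, bitWeight q (s x)) * winShare (fun x => resample a b (ω x) (s x)) a)
    (g := fun s => 1 - r ^ (cnt (fun x => resample a b (ω x) (s x)) a -
        cnt (fun x => resample a b (ω x) (s x)) b))
    (fun _ => zero_le_one)
    (fun s => mul_nonneg (prod_bitWeight_nonneg hq0 hq1 s) (winShare_nonneg _ _))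
    (fun s => sub_nonneg.mpr (pow_le_one₀ hr0 hr1))
    ((prod_bitWeight_mono hq hq1).mul (winShare_resample_mono hab ω)
      (fun s => prod_bitWeight_nonneg hq0 hq1 s) (fun s => winShare_nonneg _ _))
    (fun s t hst => sub_le_sub_left (pow_le_pow_of_le_one hr0 hr1
      (tsub_le_tsub (cnt_resample_left_mono hab ω hst) (cnt_resample_right_anti hab ω hst))) 1)
    (fun _ _ => le_rfl)
  simpa [mul_assoc] using this

lemma cnt_resample_left_add_right {k h : ℕ} {a b : Fin k} (hab : a ≠ b) (ω : Fin h → Fin k)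
    (s : Fin h → Bool) :
    cnt (fun x => resample a b (ω x) (s x)) a + cnt (fun x => resample a b (ω x) (s x)) b =
      (Finset.univ.filter fun x => ω x = a ∨ ω x = b).card := by
  rw [cnt_resample_left hab, cnt_resample_right hab]
  simpa using Finset.card_filter_add_card_filter_not
    (s := Finset.univ.filter fun x => ω x = a ∨ ω x = b) (fun x => s x = true)

/-- The winning gap dominates the part of the winning probability on which the two opinions
receive many samples. -/
lemma mul_sum_le_winPr_sub {k h : ℕ} {p : Fin k → ℝ} (hp0 : ∀ i, 0 ≤ p i) {a b : Fin k}
    (hab : a ≠ b) (ha : 0 < p a) (hba : p b ≤ p a) {c T : ℝ} (hT : 0 < T)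
    (hc : ∀ m : ℕ, T ≤ m → c ≤ 5 / 32 *
      ((1 - p b / p a) * √m / (1 + (1 - p b / p a) * √m))) :
    c * ∑ ω : Fin h → Fin k, (∏ x, p (ω x)) *
        (if T ≤ (cnt ω a + cnt ω b : ℕ) then winShare ω a else 0) ≤
      winPr k h p a - winPr k h p b := by
  have hb := hp0 b
  have hsum : 0 < p a + p b := by linarith
  have hr0 : 0 ≤ p b / p a := by positivity
  have hr1 : p b / p a ≤ 1 := (div_le_one ha).mpr hba
  have hq : 1 / 2 ≤ p a / (p a + p b) := by rw [div_le_div_iff₀ two_pos hsum]; linarith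
  have hq1 : p a / (p a + p b) ≤ 1 := (div_le_one hsum).mpr (by linarith)
  have hq0 : 0 ≤ p a / (p a + p b) := by positivity
  rw [winPr_sub_winPr p hab ha.ne', Finset.mul_sum]
  simp_rw [mul_left_comm c]
  rw [← sum_resample p hab hsum.ne', ← sum_resample p hab hsum.ne' (fun ω => _ * (1 - _))]
  refine Finset.sum_le_sum fun ω _ => ?_
  simp_rw [mul_assoc (∏ x, p (ω x))]
  rw [← Finset.mul_sum, ← Finset.mul_sum]
  refine mul_le_mul_of_nonneg_left ?_ (Finset.prod_nonneg fun x _ => hp0 _)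
  simp_rw [cnt_resample_left_add_right hab]
  by_cases hm : T ≤ (Finset.univ.filter fun x => ω x = a ∨ ω x = b).card
  · simp_rw [if_pos hm, mul_left_comm _ c]
    rw [← Finset.mul_sum]
    have hcorr := winShare_gain_correlation hab hq hq1 hr0 hr1 ω
    have hcard : 0 < (Finset.univ.filter fun x => ω x = a ∨ ω x = b).card := by
      exact_mod_cast hT.trans_le hm
    have hgain := sum_one_sub_pow_ge hr0 hr1 hcard
    simp_rw [← cnt_resample_left hab, ← cnt_resample_right hab, Fintype.card_fin] at hgain
    have hpow : (0 : ℝ) < 2 ^ h := by positivity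
    have hS : 0 ≤ ∑ s : Fin h → Bool, (∏ x, bitWeight (p a / (p a + p b)) (s x)) *
        winShare (fun x => resample a b (ω x) (s x)) a :=
      Finset.sum_nonneg fun s _ =>
        mul_nonneg (prod_bitWeight_nonneg hq0 hq1 s) (winShare_nonneg _ _)
    have h1 := mul_le_mul_of_nonneg_left
      ((mul_le_mul_of_nonneg_left (hc _ hm) hpow.le).trans hgain) hS
    refine le_of_mul_le_mul_left ?_ hpow
    linarith
  · simp_rw [if_neg hm, mul_zero, Finset.sum_const_zero]
    exact Finset.sum_nonneg fun s _ => mul_nonneg (prod_bitWeight_nonneg hq0 hq1 s)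
      (mul_nonneg (winShare_nonneg _ _) (sub_nonneg.mpr (pow_le_one₀ hr0 hr1)))

lemma winPr_le_winPr {k h : ℕ} {p : Fin k → ℝ} (hp0 : ∀ i, 0 ≤ p i) {a b : Fin k}
    (ha : 0 < p a) (hba : p b ≤ p a) : winPr k h p b ≤ winPr k h p a := by
  by_cases hab : a = b
  · rw [hab]
  rw [← sub_nonneg, winPr_sub_winPr p hab ha.ne']
  exact Finset.sum_nonneg fun ω _ => mul_nonneg (Finset.prod_nonneg fun x _ => hp0 _)
    (mul_nonneg (winShare_nonneg _ _) (sub_nonneg.mpr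
      (pow_le_one₀ (div_nonneg (hp0 b) ha.le) ((div_le_one ha).mpr hba))))

/-- A Chernoff bound for the lower tail of the number of samples of one opinion. -/
lemma sum_cnt_lt_le_exp {k h : ℕ} {p : Fin k → ℝ} (hp0 : ∀ i, 0 ≤ p i) (hp : ∑ i, p i = 1)
    (a : Fin k) :
    ∑ ω : Fin h → Fin k, (∏ x, p (ω x)) * (if (cnt ω a : ℝ) < h * p a / 4 then 1 else 0) ≤
      Real.exp (-(h * p a / 4)) := by
  have hmgf : ∑ ω : Fin h → Fin k, (∏ x, p (ω x)) * Real.exp (-(cnt ω a : ℝ)) =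
      (1 - p a * (1 - Real.exp (-1))) ^ h := by
    have hcnt (ω : Fin h → Fin k) : Real.exp (-(cnt ω a : ℝ)) =
        ∏ x, (if ω x = a then Real.exp (-1) else 1) := by
      rw [Finset.prod_ite, Finset.prod_const, Finset.prod_const_one, mul_one, ← Real.exp_nat_mul]
      simp [cnt]
    simp_rw [hcnt, ← Finset.prod_mul_distrib]
    rw [← Fintype.prod_sum (f := fun (_ : Fin h) i => p i * if i = a then Real.exp (-1) else 1),
      Finset.prod_const, Finset.card_univ, Fintype.card_fin]
    congr 1
    have (i : Fin k) : (p i * if i = a then Real.exp (-1) else 1) =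
        p i - if i = a then p i * (1 - Real.exp (-1)) else 0 := by
      split_ifs <;> ring
    simp_rw [this, Finset.sum_sub_distrib, hp]
    simp
  have he : Real.exp (-1) ≤ 1 / 2 := by
    rw [Real.exp_neg, inv_eq_one_div]
    exact one_div_le_one_div_of_le two_pos (by linarith [Real.add_one_le_exp (1 : ℝ)])
  have hpa1 : p a ≤ 1 := hp ▸ Finset.single_le_sum (fun i _ => hp0 i) (Finset.mem_univ a)
  have hmgf_le : (1 - p a * (1 - Real.exp (-1))) ^ h ≤ Real.exp (-(h * p a / 2)) := by
    calc (1 - p a * (1 - Real.exp (-1))) ^ h ≤ Real.exp (-(p a / 2)) ^ h := by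
          refine pow_le_pow_left₀ ?_ ?_ h
          · nlinarith [Real.exp_pos (-1), hp0 a]
          · nlinarith [Real.add_one_le_exp (-(p a / 2)), hp0 a]
      _ = Real.exp (-(h * p a / 2)) := by
          rw [← Real.exp_nat_mul]
          congr 1
          ring
  calc _ ≤ ∑ ω : Fin h → Fin k, Real.exp (h * p a / 4) *
        ((∏ x, p (ω x)) * Real.exp (-(cnt ω a : ℝ))) := by
        refine Finset.sum_le_sum fun ω _ => ?_
        rw [mul_left_comm, ← Real.exp_add]
        refine mul_le_mul_of_nonneg_left ?_ (Finset.prod_nonneg fun x _ => hp0 _)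
        split_ifs with hlt
        · exact Real.one_le_exp (by linarith)
        · positivity
    _ = Real.exp (h * p a / 4) * (1 - p a * (1 - Real.exp (-1))) ^ h := by
        rw [← Finset.mul_sum, hmgf]
    _ ≤ Real.exp (h * p a / 4) * Real.exp (-(h * p a / 2)) := by gcongr
    _ = Real.exp (-(h * p a / 4)) := by
        rw [← Real.exp_add]
        congr 1
        ring

lemma exp_neg_le_of_log_le {n t : ℝ} (hn : 2 ≤ n) (ht : 324 * Real.log n ≤ t) :
    Real.exp (-(t / 4)) ≤ 1 / (2 * n) := by
  have hlog : 0 ≤ Real.log n := Real.log_nonneg (by linarith)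
  have h1 : Real.exp (-(t / 4)) ≤ Real.exp (-(Real.log n + Real.log n)) :=
    Real.exp_le_exp.mpr (by linarith)
  refine h1.trans ?_
  rw [Real.exp_neg, Real.exp_add, Real.exp_log (by linarith), inv_eq_one_div]
  exact one_div_le_one_div_of_le (by linarith) (by nlinarith)

/-- At least half of the winning probability of a most likely opinion comes from samples on which
it receives a constant fraction of its expected number of samples. -/
lemma half_winPr_le_sum {n k h : ℕ} (hn : 2 ≤ n) (hkn : k ≤ n) {p : Fin k → ℝ}
    (hp0 : ∀ i, 0 ≤ p i) (hp : ∑ i, p i = 1) {a : Fin k} (ha : 0 < p a)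
    (hmax : ∀ i, p i ≤ p a) (hlog : 324 * Real.log n ≤ h * p a) (b : Fin k) :
    winPr k h p a / 2 ≤ ∑ ω : Fin h → Fin k, (∏ x, p (ω x)) *
        (if h * p a / 4 ≤ (cnt ω a + cnt ω b : ℕ) then winShare ω a else 0) := by
  have hn' : (2 : ℝ) ≤ n := by exact_mod_cast hn
  have hwin : 1 / (n : ℝ) ≤ winPr k h p a := by
    have hle : (1 : ℝ) ≤ k * winPr k h p a := by
      calc (1 : ℝ) = ∑ i, winPr k h p i := (sum_winPr h hp a).symm
        _ ≤ ∑ _i : Fin k, winPr k h p a :=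
          Finset.sum_le_sum fun i _ => winPr_le_winPr hp0 ha (hmax i)
        _ = k * winPr k h p a := by simp
    have hw0 : 0 ≤ winPr k h p a := by
      rw [winPr_eq_sum]
      exact Finset.sum_nonneg fun ω _ =>
        mul_nonneg (Finset.prod_nonneg fun x _ => hp0 _) (winShare_nonneg _ _)
    have hkn' : (k : ℝ) ≤ n := by exact_mod_cast hkn
    rw [div_le_iff₀ (by linarith)]
    nlinarith
  have htail : ∑ ω : Fin h → Fin k,
      (∏ x, p (ω x)) * (if (cnt ω a : ℝ) < h * p a / 4 then 1 else 0) ≤ 1 / (2 * (n : ℝ)) :=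
    (sum_cnt_lt_le_exp hp0 hp a).trans (exp_neg_le_of_log_le hn' hlog)
  have hsplit : winPr k h p a ≤
      ∑ ω : Fin h → Fin k, (∏ x, p (ω x)) *
        (if h * p a / 4 ≤ (cnt ω a + cnt ω b : ℕ) then winShare ω a else 0) +
      ∑ ω : Fin h → Fin k,
        (∏ x, p (ω x)) * (if (cnt ω a : ℝ) < h * p a / 4 then 1 else 0) := by
    rw [winPr_eq_sum, ← Finset.sum_add_distrib]
    refine Finset.sum_le_sum fun ω _ => ?_
    rw [← mul_add]
    refine mul_le_mul_of_nonneg_left ?_ (Finset.prod_nonneg fun x _ => hp0 _)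
    by_cases h1 : h * p a / 4 ≤ (cnt ω a + cnt ω b : ℕ)
    · rw [if_pos h1]
      split_ifs <;> linarith
    · have h2 : (cnt ω a : ℝ) < h * p a / 4 := by
        push_cast at h1
        linarith [(Nat.cast_nonneg (cnt ω b) : (0 : ℝ) ≤ cnt ω b)]
      rw [if_neg h1, if_pos h2, zero_add]
      exact winShare_le_one ω a
  have : 1 / (2 * (n : ℝ)) = 1 / n / 2 := by rw [div_div, mul_comm]
  linarith

/-- The scaled bias is bounded by the gain of the fair walk with at least `h * x / 4` steps. -/
lemma scaled_bias_le_gain {h : ℕ} (hh : 1 ≤ h) {x y z m : ℝ} (hx : 0 < x) (hy : 0 ≤ y)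
    (hz : z ≤ x) (hbias : x - z ≤ √(2 * (x + y) / h)) (hm : h * x / 4 ≤ m) :
    5 / 128 * ((x - z) * √(h / (x + y))) ≤
      5 / 32 * ((1 - z / x) * √m / (1 + (1 - z / x) * √m)) := by
  have hh' : (0 : ℝ) < h := by exact_mod_cast hh
  have hxy : 0 < x + y := by linarith
  set u := (x - z) * √(h / (x + y)) with hu
  have hu0 : 0 ≤ u := mul_nonneg (by linarith) (Real.sqrt_nonneg _)
  have hu2 : u ≤ 2 := by
    calc u ≤ √(2 * (x + y) / h) * √(h / (x + y)) :=
          mul_le_mul_of_nonneg_right hbias (Real.sqrt_nonneg _)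
      _ = √2 := by
        rw [← Real.sqrt_mul (by positivity)]
        congr 1
        field_simp
      _ ≤ 2 := by
        rw [Real.sqrt_le_left (by norm_num)]
        norm_num
  have hκ : u / 2 ≤ (1 - z / x) * √m := by
    have hroot : √(h / (x + y)) / 2 ≤ √m / x := by
      rw [le_div_iff₀ hx]
      refine Real.le_sqrt_of_sq_le ?_
      rw [mul_pow, div_pow, Real.sq_sqrt (by positivity)]
      refine le_trans ?_ hm
      have : h / (x + y) ≤ h / x := div_le_div_of_nonneg_left hh'.le hx (by linarith)
      calc h / (x + y) / 2 ^ 2 * x ^ 2 ≤ h / x / 2 ^ 2 * x ^ 2 := by gcongr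
        _ = h * x / 4 := by field_simp; norm_num
    calc u / 2 = (x - z) * (√(h / (x + y)) / 2) := by rw [hu]; ring
      _ ≤ (x - z) * (√m / x) := mul_le_mul_of_nonneg_left hroot (by linarith)
      _ = (1 - z / x) * √m := by field_simp
  have hgain : u / 4 ≤ (1 - z / x) * √m / (1 + (1 - z / x) * √m) := by
    rw [le_div_iff₀ (by linarith)]
    nlinarith
  linarith

/-- there is a constant `C5 > 0` such that for `n` large enough,
`k ≤ n`, `p_1 ≥ … ≥ p_k`, `h·p_1 ≥ 324·log n`, and every opinion `j ≠ 1` whose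
bias `δ(j) = p_1 - p_j` satisfies `δ(j) ≤ √(2(p_1 + p_2)/h)`, one has
`Pr(W_1) - Pr(W_j) ≥ C5·δ(j)·√(h/(p_1 + p_2))·Pr(W_1)`. -/
theorem win_diff_small_bias_lower_bound :
    ∃ C5 : ℝ, 0 < C5 ∧
      ∃ n0 : ℕ, ∀ (n k h : ℕ), n0 ≤ n → ∀ (hk : 2 ≤ k), 1 ≤ h → k ≤ n →
        ∀ p : Fin k → ℝ, (∀ i, 0 ≤ p i) → ∑ i, p i = 1 →
          (∀ i j : Fin k, i ≤ j → p j ≤ p i) →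
          324 * Real.log n ≤ (h : ℝ) * p (o₁ k hk) →
          ∀ j : Fin k, j ≠ o₁ k hk →
            p (o₁ k hk) - p j ≤ Real.sqrt (2 * (p (o₁ k hk) + p (o₂ k hk)) / h) →
            C5 * (p (o₁ k hk) - p j) *
                Real.sqrt ((h : ℝ) / (p (o₁ k hk) + p (o₂ k hk))) *
                winPr k h p (o₁ k hk) ≤
              winPr k h p (o₁ k hk) - winPr k h p j := by
  refine ⟨5 / 256, by norm_num, 2, ?_⟩
  intro n k h hn hk hh hkn p hp0 hp hanti hlog j hj hbias
  have hmax (i : Fin k) : p i ≤ p (o₁ k hk) := hanti _ _ (Fin.mk_le_of_le_val (Nat.zero_le _))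
  have ha : 0 < p (o₁ k hk) := by
    by_contra hneg
    have hzero : ∑ i, p i = 0 := Finset.sum_eq_zero fun i _ =>
      le_antisymm ((hmax i).trans (not_lt.mp hneg)) (hp0 i)
    linarith
  have hh' : (0 : ℝ) < h := by exact_mod_cast hh
  have hgap := mul_sum_le_winPr_sub (h := h) hp0 hj.symm ha (hmax j)
    (T := h * p (o₁ k hk) / 4) (by positivity)
    (fun m hm => scaled_bias_le_gain hh ha (hp0 (o₂ k hk)) (hmax j) hbias hm)
  have hc : 0 ≤ 5 / 128 * ((p (o₁ k hk) - p j) * √(h / (p (o₁ k hk) + p (o₂ k hk)))) :=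
    mul_nonneg (by norm_num) (mul_nonneg (sub_nonneg.mpr (hmax j)) (Real.sqrt_nonneg _))
  have hhalf := mul_le_mul_of_nonneg_left
    (half_winPr_le_sum hn hkn hp0 hp ha hmax hlog j) hc
  linarith
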